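/- For every β > 0 and λ > 0, define F(t) = ∫_{λt}^∞ (2π t)^{-1/2} e^{-x²/(2t)} dx + (β/2) e^{β² t/2} ∫_{λt}^∞ Erfc((x - βt)/√(2t)) e^{-βx} dx. Then (1/t) · log F(t) → Δ_λ as t → ∞, where Δ_λ = β²/2 − βλ if λ < β and Δ_λ = −λ²/2 if λ ≥ β. -/

import Mathlib

open MeasureTheory Real Set Filter

/-- The complementary error function `Erfc`. -/
noncomputable def erfc (x : ℝ) : ℝ :=
  (2 / Real.sqrt Real.pi) * ∫ u in Set.Ioi x, Real.exp (-u ^ 2)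

lemma aux_int_gauss : Integrable (fun u : ℝ => Real.exp (-u ^ 2)) := by
  simpa using integrable_exp_neg_mul_sq (b := 1) one_pos

lemma aux_erfc_anti : Antitone erfc := by
  intro a b hab
  unfold erfc
  apply mul_le_mul_of_nonneg_left _ (by positivity)
  exact setIntegral_mono_set aux_int_gauss.integrableOn
    (Eventually.of_forall fun x => (Real.exp_pos _).le) (Ioi_subset_Ioi hab).eventuallyLE

lemma aux_erfc_nonneg (x : ℝ) : 0 ≤ erfc x := by
  unfold erfc
  exact mul_nonneg (by positivity) (integral_nonneg fun _ => (Real.exp_pos _).le)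

lemma aux_erfc_zero : erfc 0 = 1 := by
  have h := integral_gaussian_Ioi 1
  simp only [neg_mul, one_mul, div_one] at h
  unfold erfc
  rw [h]
  have : Real.sqrt Real.pi ≠ 0 := by positivity
  field_simp

lemma aux_erfc_le_two (x : ℝ) : erfc x ≤ 2 := by
  have h := integral_gaussian 1
  simp only [neg_mul, one_mul, div_one] at h
  have h2 : (∫ u in Set.Ioi x, Real.exp (-u ^ 2)) ≤ Real.sqrt Real.pi := by
    rw [← h]
    exact setIntegral_le_integral aux_int_gauss
      (Eventually.of_forall fun x => (Real.exp_pos _).le)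
  have : 0 < Real.sqrt Real.pi := by positivity
  unfold erfc
  calc _ ≤ 2 / Real.sqrt Real.pi * Real.sqrt Real.pi :=
        mul_le_mul_of_nonneg_left h2 (by positivity)
    _ = 2 := by field_simp

lemma aux_erfc_le_exp (y : ℝ) (hy : 0 ≤ y) : erfc y ≤ Real.exp (-y ^ 2) := by
  have h1 : (∫ u in Set.Ioi y, Real.exp (-u ^ 2))
      = ∫ v in Set.Ioi (0:ℝ), Real.exp (-(v + y) ^ 2) := by
    have := (measurePreserving_add_right volume y).setIntegral_preimage_emb
      (measurableEmbedding_addRight y) (fun u : ℝ => Real.exp (-u ^ 2)) (Ioi y)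
    simpa using this.symm
  have h2 : (∫ v in Set.Ioi (0:ℝ), Real.exp (-(v + y) ^ 2))
      ≤ ∫ v in Set.Ioi (0:ℝ), Real.exp (-y ^ 2) * Real.exp (-v ^ 2) := by
    apply setIntegral_mono_on
    · exact (aux_int_gauss.comp_add_right y).integrableOn
    · exact (aux_int_gauss.const_mul _).integrableOn
    · exact measurableSet_Ioi
    · intro v hv
      have hv : 0 < v := hv
      rw [← Real.exp_add]
      apply Real.exp_le_exp.2
      nlinarith [mul_nonneg hv.le hy]
  rw [integral_const_mul] at h2
  have h0 := aux_erfc_zero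
  unfold erfc at h0 ⊢
  rw [h1]
  calc _ ≤ 2 / Real.sqrt Real.pi *
        (Real.exp (-y ^ 2) * ∫ v in Set.Ioi (0:ℝ), Real.exp (-v ^ 2)) :=
        mul_le_mul_of_nonneg_left h2 (by positivity)
    _ = Real.exp (-y ^ 2) * (2 / Real.sqrt Real.pi *
        ∫ v in Set.Ioi (0:ℝ), Real.exp (-v ^ 2)) := by ring
    _ = _ := by rw [h0, mul_one]

lemma aux_int_lower (f : ℝ → ℝ) (a c : ℝ) (hf : IntegrableOn f (Ioi a))
    (h0 : ∀ x, 0 ≤ f x) (h : ∀ x ∈ Ioc a (a + 1), c ≤ f x) :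
    c ≤ ∫ x in Ioi a, f x := by
  have h1 : (∫ x in Ioc a (a+1), f x) ≤ ∫ x in Ioi a, f x :=
    setIntegral_mono_set hf (Eventually.of_forall h0) Ioc_subset_Ioi_self.eventuallyLE
  have h2 : (∫ x in Ioc a (a+1), c) ≤ ∫ x in Ioc a (a+1), f x := by
    apply setIntegral_mono_on _ (hf.mono_set Ioc_subset_Ioi_self) measurableSet_Ioc h
    exact integrableOn_const (by simp)
  simp at h2
  linarith

lemma aux_squeeze (F : ℝ → ℝ) (D K₁ K₂ : ℝ) (h1 : 0 < K₁) (h2 : 0 < K₂)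
    (hlo : ∀ᶠ t in atTop, K₁ * t⁻¹ * Real.exp (D * t) ≤ F t)
    (hup : ∀ᶠ t in atTop, F t ≤ K₂ * Real.exp (D * t)) :
    Tendsto (fun t => (1 / t) * Real.log (F t)) atTop (nhds D) := by
  have hinv : Tendsto (fun t : ℝ => t⁻¹) atTop (nhds 0) := tendsto_inv_atTop_zero
  have hlog : Tendsto (fun t : ℝ => Real.log t / t) atTop (nhds 0) := by
    have := Real.isLittleO_log_id_atTop.tendsto_div_nhds_zero
    simpa using this
  have hA : Tendsto (fun t : ℝ => Real.log K₁ * t⁻¹ - Real.log t / t + D) atTop (nhds D) := by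
    simpa using ((hinv.const_mul (Real.log K₁)).sub hlog).add_const D
  have hB : Tendsto (fun t : ℝ => Real.log K₂ * t⁻¹ + D) atTop (nhds D) := by
    simpa using (hinv.const_mul (Real.log K₂)).add_const D
  refine tendsto_of_tendsto_of_tendsto_of_le_of_le' hA hB ?_ ?_
  · filter_upwards [hlo, eventually_gt_atTop 0] with t ht htp
    have := Real.log_le_log (by positivity) ht
    rw [Real.log_mul (by positivity) (by positivity), Real.log_mul (by positivity) (by positivity),
      Real.log_exp, Real.log_inv] at this
    calc _ = (1 / t) * (Real.log K₁ + -Real.log t + D * t) := by field_simp; ring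
      _ ≤ _ := mul_le_mul_of_nonneg_left this (by positivity)
  · filter_upwards [hlo, hup, eventually_gt_atTop 0] with t ht ht' htp
    have hp : 0 < F t := lt_of_lt_of_le (by positivity) ht
    have := Real.log_le_log hp ht'
    rw [Real.log_mul (by positivity) (by positivity), Real.log_exp] at this
    calc _ ≤ (1 / t) * (Real.log K₂ + D * t) := mul_le_mul_of_nonneg_left this (by positivity)
      _ = _ := by field_simp

lemma aux_int_g (t : ℝ) (ht : 0 < t) : Integrable (fun x : ℝ => Real.exp (-x ^ 2 / (2 * t))) := by
  have := integrable_exp_neg_mul_sq (b := 1 / (2 * t)) (by positivity)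
  refine this.congr (Eventually.of_forall fun x => ?_)
  simp only
  congr 1
  ring

lemma aux_gtail (l t : ℝ) (hl : 0 < l) (ht : 0 < t) :
    (∫ x in Ioi (l * t), Real.exp (-x ^ 2 / (2 * t))) ≤ 1 / l * Real.exp (-l ^ 2 / 2 * t) := by
  have h : (∫ x in Ioi (l * t), Real.exp (-x ^ 2 / (2 * t)))
      ≤ ∫ x in Ioi (l * t), Real.exp (l ^ 2 * t / 2) * Real.exp (-l * x) := by
    apply setIntegral_mono_on (aux_int_g t ht).integrableOn _ measurableSet_Ioi
    · intro x _
      rw [← Real.exp_add]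
      apply Real.exp_le_exp.2
      rw [div_le_iff₀ (by positivity)]
      nlinarith [sq_nonneg (x - l * t)]
    · exact (integrableOn_exp_mul_Ioi (by linarith) _).const_mul _
  rw [integral_const_mul, integral_exp_mul_Ioi (by linarith)] at h
  refine h.trans (le_of_eq ?_)
  have : -l ^ 2 / 2 * t = l ^ 2 * t / 2 + -l * (l * t) := by ring
  rw [this, Real.exp_add]
  field_simp

lemma aux_int_B (β t a : ℝ) (hβ : 0 < β) :
    IntegrableOn (fun x => erfc ((x - β * t) / Real.sqrt (2 * t)) * Real.exp (-β * x)) (Ioi a) := by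
  have h : IntegrableOn (fun x => Real.exp (-β * x)) (Ioi a) :=
    integrableOn_exp_mul_Ioi (by linarith) _
  refine Integrable.bdd_mul (c := 2) h ?_ ?_
  · apply Measurable.aestronglyMeasurable
    exact aux_erfc_anti.measurable.comp (by fun_prop)
  · refine Eventually.of_forall fun x => ?_
    rw [Real.norm_eq_abs, abs_of_nonneg (aux_erfc_nonneg _)]
    exact aux_erfc_le_two _

/-- Expected population growth rates (Lemma 1.2): with
`F t = ∫_{λt}^∞ (2πt)^{-1/2} e^{-x²/(2t)} dx
      + (β/2) e^{β²t/2} ∫_{λt}^∞ Erfc((x - βt)/√(2t)) e^{-βx} dx`,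
one has `(1/t) log F(t) → Δ_λ` as `t → ∞`. -/
theorem expected_population_log_asymptotics (β l : ℝ) (hβ : 0 < β) (hl : 0 < l) :
    Tendsto (fun t : ℝ =>
        (1 / t) * Real.log
          ((∫ x in Set.Ioi (l * t),
              (Real.sqrt (2 * Real.pi * t))⁻¹ * Real.exp (-x ^ 2 / (2 * t))) +
            (β / 2) * Real.exp (β ^ 2 * t / 2) *
              ∫ x in Set.Ioi (l * t),
                erfc ((x - β * t) / Real.sqrt (2 * t)) * Real.exp (-β * x)))
      atTop (nhds (if l < β then β ^ 2 / 2 - β * l else -l ^ 2 / 2)) := by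
  have hAup : ∀ t : ℝ, 1 ≤ t → (∫ x in Set.Ioi (l * t),
      (Real.sqrt (2 * Real.pi * t))⁻¹ * Real.exp (-x ^ 2 / (2 * t)))
      ≤ 1 / l * Real.exp (-l ^ 2 / 2 * t) := by
    intro t ht
    rw [integral_const_mul]
    have h1 : 1 ≤ Real.sqrt (2 * Real.pi * t) := by
      rw [Real.one_le_sqrt]
      nlinarith [Real.pi_gt_three]
    have h2 := inv_le_one_of_one_le₀ h1
    have h3 := aux_gtail l t hl (by linarith)
    have h4 : 0 ≤ ∫ x in Ioi (l * t), Real.exp (-x ^ 2 / (2 * t)) :=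
      integral_nonneg fun _ => (Real.exp_pos _).le
    nlinarith
  have hA0 : ∀ t : ℝ, 0 ≤ (∫ x in Set.Ioi (l * t),
      (Real.sqrt (2 * Real.pi * t))⁻¹ * Real.exp (-x ^ 2 / (2 * t))) := fun t =>
    integral_nonneg fun _ => by positivity
  have hB0 : ∀ t : ℝ, 0 ≤ (β / 2) * Real.exp (β ^ 2 * t / 2) * ∫ x in Set.Ioi (l * t),
      erfc ((x - β * t) / Real.sqrt (2 * t)) * Real.exp (-β * x) := fun t =>
    mul_nonneg (by positivity)
      (integral_nonneg fun _ => mul_nonneg (aux_erfc_nonneg _) (Real.exp_pos _).le)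
  split_ifs with hlt
  · refine aux_squeeze _ _ (β / 2 * Real.exp (-β)) (1 / l + 1) (by positivity) (by positivity) ?_ ?_
    · filter_upwards [eventually_ge_atTop 1, eventually_ge_atTop (1 / (β - l))] with t ht ht2
      refine le_trans ?_ (le_add_of_nonneg_left (hA0 t))
      have hbl : 0 < β - l := by linarith
      rw [div_le_iff₀ hbl] at ht2
      have key := aux_int_lower _ (l * t) (Real.exp (-β * (l * t + 1)))
        (aux_int_B β t (l * t) hβ)
        (fun _ => mul_nonneg (aux_erfc_nonneg _) (Real.exp_pos _).le) (by
          intro x hx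
          have h1 : 1 ≤ erfc ((x - β * t) / Real.sqrt (2 * t)) := by
            rw [← aux_erfc_zero]
            apply aux_erfc_anti
            apply div_nonpos_of_nonpos_of_nonneg _ (Real.sqrt_nonneg _)
            nlinarith [hx.2]
          have h2 : Real.exp (-β * (l * t + 1)) ≤ Real.exp (-β * x) := by
            apply Real.exp_le_exp.2
            nlinarith [hx.2]
          nlinarith [Real.exp_pos (-β * x)])
      calc _ ≤ β / 2 * Real.exp (-β) * 1 * Real.exp ((β ^ 2 / 2 - β * l) * t) := by
            gcongr
            exact inv_le_one_of_one_le₀ ht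
        _ = (β / 2) * Real.exp (β ^ 2 * t / 2) * Real.exp (-β * (l * t + 1)) := by
            rw [mul_one, mul_assoc, mul_assoc, ← Real.exp_add, ← Real.exp_add]
            ring_nf
        _ ≤ _ := mul_le_mul_of_nonneg_left key (by positivity)
    · filter_upwards [eventually_ge_atTop 1] with t ht
      have h1 : Real.exp (-l ^ 2 / 2 * t) ≤ Real.exp ((β ^ 2 / 2 - β * l) * t) := by
        apply Real.exp_le_exp.2
        nlinarith [mul_nonneg (sq_nonneg (β - l)) (by linarith : (0:ℝ) ≤ t)]
      have h2 : (∫ x in Set.Ioi (l * t),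
          erfc ((x - β * t) / Real.sqrt (2 * t)) * Real.exp (-β * x))
          ≤ ∫ x in Set.Ioi (l * t), 2 * Real.exp (-β * x) := by
        apply setIntegral_mono_on (aux_int_B β t _ hβ)
          ((integrableOn_exp_mul_Ioi (by linarith) _).const_mul _) measurableSet_Ioi
        intro x _
        exact mul_le_mul_of_nonneg_right (aux_erfc_le_two _) (Real.exp_pos _).le
      rw [integral_const_mul, integral_exp_mul_Ioi (by linarith)] at h2
      rw [add_mul]
      apply add_le_add
      · exact (hAup t ht).trans (mul_le_mul_of_nonneg_left h1 (by positivity))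
      · refine (mul_le_mul_of_nonneg_left h2 (by positivity)).trans (le_of_eq ?_)
        have : (β ^ 2 / 2 - β * l) * t = β ^ 2 * t / 2 + -β * (l * t) := by ring
        rw [this, Real.exp_add]
        field_simp
  · push Not at hlt
    refine aux_squeeze _ _ ((2 * Real.pi)⁻¹ * Real.exp (-l - 1 / 2)) (1 / l + β / 2 * (1 / l))
      (by positivity) (by positivity) ?_ ?_
    · filter_upwards [eventually_ge_atTop 1] with t ht
      refine le_trans ?_ (le_add_of_nonneg_right (hB0 t))
      have ht0 : 0 < t := by linarith
      apply aux_int_lower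
      · exact ((aux_int_g t ht0).const_mul _).integrableOn
      · intro x; positivity
      · intro x hx
        have hx0 : 0 < x := lt_trans (by positivity) hx.1
        have h1 : (2 * Real.pi * t)⁻¹ ≤ (Real.sqrt (2 * Real.pi * t))⁻¹ := by
          apply inv_anti₀ (by positivity)
          have : 1 ≤ 2 * Real.pi * t := by nlinarith [Real.pi_gt_three]
          rw [Real.sqrt_le_left (by positivity)]
          nlinarith
        have h2 : Real.exp (-l - 1 / 2 + -l ^ 2 / 2 * t) ≤ Real.exp (-x ^ 2 / (2 * t)) := by
          apply Real.exp_le_exp.2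
          rw [le_div_iff₀ (by positivity)]
          have : x ^ 2 ≤ (l * t + 1) ^ 2 := by
            apply pow_le_pow_left₀ hx0.le hx.2
          nlinarith
        calc _ = (2 * Real.pi * t)⁻¹ * Real.exp (-l - 1 / 2 + -l ^ 2 / 2 * t) := by
              rw [Real.exp_add, mul_inv (2 * Real.pi)]; ring
          _ ≤ _ := by gcongr
    · filter_upwards [eventually_ge_atTop 1] with t ht
      have ht0 : 0 < t := by linarith
      rw [add_mul]
      apply add_le_add (hAup t ht)
      rw [mul_assoc, mul_assoc]
      apply mul_le_mul_of_nonneg_left _ (by positivity)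
      refine le_trans ?_ (aux_gtail l t hl ht0)
      rw [← integral_const_mul]
      apply setIntegral_mono_on ((aux_int_B β t _ hβ).const_mul _)
        (aux_int_g t ht0).integrableOn measurableSet_Ioi
      intro x hx
      have hx : l * t < x := hx
      have hy : 0 ≤ (x - β * t) / Real.sqrt (2 * t) := by
        apply div_nonneg _ (Real.sqrt_nonneg _)
        nlinarith
      calc _ ≤ Real.exp (β ^ 2 * t / 2) *
            (Real.exp (-((x - β * t) / Real.sqrt (2 * t)) ^ 2) * Real.exp (-β * x)) := by
            gcongr
            exact aux_erfc_le_exp _ hy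
        _ = _ := by
            rw [← Real.exp_add, ← Real.exp_add, div_pow, Real.sq_sqrt (by positivity)]
            congr 1
            field_simp
            ring
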